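/- Let γ, ν > 0 and u ∈ C²(ℝ³;ℝ³) with bounded derivatives, ω = ∇×u. Fix C_0 = 0 and view Γ[u,C] and Ψ[u,C] as functions of the free vertices C_1,…,C_{N-1}. For every 2 ≤ k ≤ N−2, Migdal's vorticity operator Ω^M_k := (iν/γ)( Σ_{j=k+1}^{N-1} ∇_{C_j} + (1/2) ∇_{C_k} ) × ∇_{C_k} satisfies Ω^M_k Ψ[u,C] = ⟨ω⟩_k(C_k) Ψ[u,C] − R^k_{ad} Ψ[u,C] − (iγ/ν) Ψ[u,C] ( Σ_{j=k+1}^{N-1} ∇_{C_j} Γ[u,C] ) × ( ∇_{C_k} Γ[u,C] ), where R^k_{ad} satisfies |R^k_{ad}| ≤ c ‖Dω‖_{L^∞} |C_{k+1} − C_{k-1}| for a universal constant c. -/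

import Mathlib

noncomputable section

open scoped RealInnerProductSpace BigOperators
open MeasureTheory

/-- ℝ³ as a Euclidean space. -/
abbrev E3 : Type := EuclideanSpace ℝ (Fin 3)

/-- The vector of `E3` with the three given coordinates. -/
def vec3 (a b c : ℝ) : E3 := (WithLp.equiv 2 (Fin 3 → ℝ)).symm ![a, b, c]

/-- Cross product on `E3`. -/
def cross3 (v w : E3) : E3 :=
  vec3 (v 1 * w 2 - v 2 * w 1) (v 2 * w 0 - v 0 * w 2) (v 0 * w 1 - v 1 * w 0)

/-- `j`-th standard basis vector of `E3`. -/
def e3 (j : Fin 3) : E3 := EuclideanSpace.single j 1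

/-- Curl (vorticity) of a vector field on `E3`. -/
def curl3 (u : E3 → E3) (x : E3) : E3 :=
  vec3 (fderiv ℝ u x (e3 1) 2 - fderiv ℝ u x (e3 2) 1)
       (fderiv ℝ u x (e3 2) 0 - fderiv ℝ u x (e3 0) 2)
       (fderiv ℝ u x (e3 0) 1 - fderiv ℝ u x (e3 1) 0)

/-- Divergence of a vector field on `E3`. -/
def div3 (u : E3 → E3) (x : E3) : ℝ := ∑ j : Fin 3, fderiv ℝ u x (e3 j) j

/-- Componentwise Laplacian of a vector field on `E3`. -/
def lap3 (u : E3 → E3) (x : E3) : E3 :=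
  ∑ j : Fin 3, fderiv ℝ (fun y => fderiv ℝ u y (e3 j)) x (e3 j)

/-- Transposed Jacobian of `ω` at `x`, applied to `v`:  `((Dω)ᵀ v)_j = ∑_i ∂_j ω_i v_i`. -/
def jacT (ω : E3 → E3) (x v : E3) : E3 :=
  (WithLp.equiv 2 (Fin 3 → ℝ)).symm fun j => ⟪fderiv ℝ ω x (e3 j), v⟫

/-- Sup norm of the `j`-th derivative of a vector field. -/
def supDeriv (j : ℕ) (u : E3 → E3) : ℝ := ⨆ x : E3, ‖iteratedFDeriv ℝ j u x‖

/-- `C^m` norm: maximum of the sup norms of the derivatives of order `≤ m`. -/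
def cNorm (m : ℕ) (u : E3 → E3) : ℝ :=
  (Finset.range (m + 1)).sup' (Finset.nonempty_range_iff.mpr (Nat.succ_ne_zero m))
    fun j => supDeriv j u

/-- Sobolev `H^K` norm. -/
def sobNorm (K : ℕ) (u : E3 → E3) : ℝ :=
  Real.sqrt (∑ j ∈ Finset.range (K + 1), ∫ x : E3, ‖iteratedFDeriv ℝ j u x‖ ^ 2)

/-- Circulation of `u` along the closed polygon with vertices `C 0, …, C (N-1)`. -/
def circulation (N : ℕ) [NeZero N] (u : E3 → E3) (C : Fin N → E3) : ℝ :=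
  ∑ k : Fin N, ∫ a in (0:ℝ)..(1:ℝ), ⟪u ((1 - a) • C k + a • C (k + 1)), C (k + 1) - C k⟫

/-- `⟨ω⟩` : average of `ω` along the segment joining `(xm+xp)/2` to `y`. -/
def segAvg (ω : E3 → E3) (xm y xp : E3) : E3 :=
  ∫ a in (0:ℝ)..(1:ℝ), ω (a • y + (1 - a) • ((2:ℝ)⁻¹ • (xm + xp)))

variable {N : ℕ}

/-- Partial derivative of a real functional of the vertices with respect to
the `j`-th coordinate of the vertex `k`. -/
def vpdR (k : Fin N) (j : Fin 3) (F : (Fin N → E3) → ℝ) (C : Fin N → E3) : ℝ :=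
  fderiv ℝ (fun x => F (Function.update C k x)) (C k) (e3 j)

/-- Gradient of a real functional of the vertices with respect to the vertex `k`. -/
def vgradR (k : Fin N) (F : (Fin N → E3) → ℝ) (C : Fin N → E3) : E3 :=
  gradient (fun x => F (Function.update C k x)) (C k)

/-- `∇_{C_a} × ∇_{C_b}` applied to a real functional of the vertices. -/
def gradCross (a b : Fin N) (F : (Fin N → E3) → ℝ) (C : Fin N → E3) : E3 :=
  vec3 (vpdR a 1 (vpdR b 2 F) C - vpdR a 2 (vpdR b 1 F) C)
       (vpdR a 2 (vpdR b 0 F) C - vpdR a 0 (vpdR b 2 F) C)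
       (vpdR a 0 (vpdR b 1 F) C - vpdR a 1 (vpdR b 0 F) C)

/-- Migdal's area derivative `(∑_{j>k} ∇_{C_j} + ½ ∇_{C_k}) × ∇_{C_k}` on real functionals. -/
def gradCrossM (k : Fin N) (F : (Fin N → E3) → ℝ) (C : Fin N → E3) : E3 :=
  (∑ j ∈ Finset.univ.filter (fun j : Fin N => (k : ℕ) < (j : ℕ)), gradCross j k F C)
    + (2:ℝ)⁻¹ • gradCross k k F C

/-- Partial derivative of a complex functional of the vertices. -/
def vpd (k : Fin N) (j : Fin 3) (F : (Fin N → E3) → ℂ) (C : Fin N → E3) : ℂ :=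
  fderiv ℝ (fun x => F (Function.update C k x)) (C k) (e3 j)

/-- `∇_{C_a} × ∇_{C_b}` on complex functionals. -/
def opCross (a b : Fin N) (F : (Fin N → E3) → ℂ) (C : Fin N → E3) : Fin 3 → ℂ :=
  ![vpd a 1 (vpd b 2 F) C - vpd a 2 (vpd b 1 F) C,
    vpd a 2 (vpd b 0 F) C - vpd a 0 (vpd b 2 F) C,
    vpd a 0 (vpd b 1 F) C - vpd a 1 (vpd b 0 F) C]

/-- `∇_{C_k} ×` applied to a `ℂ³`-valued functional of the vertices. -/
def vcurl (k : Fin N) (G : (Fin N → E3) → Fin 3 → ℂ) (C : Fin N → E3) : Fin 3 → ℂ :=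
  ![vpd k 1 (fun D => G D 2) C - vpd k 2 (fun D => G D 1) C,
    vpd k 2 (fun D => G D 0) C - vpd k 0 (fun D => G D 2) C,
    vpd k 0 (fun D => G D 1) C - vpd k 1 (fun D => G D 0) C]

/-- Embedding of a real vector into `ℂ³`. -/
def toC3 (v : E3) : Fin 3 → ℂ := fun j => (v j : ℂ)

/-- Bilinear (non-hermitian) dot product on `ℂ³`. -/
def cdot (v w : Fin 3 → ℂ) : ℂ := ∑ j : Fin 3, v j * w j

/-- Bilinear cross product on `ℂ³`. -/
def ccross3 (v w : Fin 3 → ℂ) : Fin 3 → ℂ :=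
  ![v 1 * w 2 - v 2 * w 1, v 2 * w 0 - v 0 * w 2, v 0 * w 1 - v 1 * w 0]

/-- Euclidean magnitude of a vector of `ℂ³`. -/
def cnorm3 (v : Fin 3 → ℂ) : ℝ := Real.sqrt (∑ j : Fin 3, Complex.normSq (v j))

/-- Pairing of a real vector with a complex vector. -/
def dotRC (v : E3) (w : Fin 3 → ℂ) : ℂ := ∑ j : Fin 3, (v j : ℂ) * w j

/-- A smooth cut-off `χ` which is `1` on `B_1(0)` and vanishes outside `B_2(0)`. -/
def IsCutoff (χ : E3 → ℝ) : Prop :=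
  ContDiff ℝ ((⊤ : ℕ∞) : WithTop ℕ∞) χ ∧ (∀ x : E3, ‖x‖ ≤ 1 → χ x = 1) ∧ (∀ x : E3, 2 ≤ ‖x‖ → χ x = 0)

/-- Kernel of the regularized Biot–Savart operator: `∇_y (χ(ℓ(x−y))/|x−y|)`. -/
def BSker (χ : E3 → ℝ) (ℓ : ℝ) (x y : E3) : E3 :=
  gradient (fun z => χ (ℓ • (x - z)) / ‖x - z‖) y

/-- Regularized Biot–Savart operator `BS_ℓ`. -/
def BSreg (χ : E3 → ℝ) (ℓ : ℝ) (ω : E3 → E3) (x : E3) : E3 :=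
  (4 * Real.pi)⁻¹ • ∫ y : E3, cross3 (ω y) (BSker χ ℓ x y)

/-- Regularized Biot–Savart operator on `ℂ³`-valued fields (componentwise). -/
def BSregC (χ : E3 → ℝ) (ℓ : ℝ) (ω : E3 → Fin 3 → ℂ) (x : E3) : Fin 3 → ℂ :=
  (4 * Real.pi)⁻¹ • ∫ y : E3, ccross3 (ω y) (toC3 (BSker χ ℓ x y))

/-- The discretized vorticity operator `Ω_k = (iν/γ) ∇_{C_{k+1}} × ∇_{C_k}`. -/
def vortOp [NeZero N] (γ ν : ℝ) (k : Fin N) (F : (Fin N → E3) → ℂ) (C : Fin N → E3) :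
    Fin 3 → ℂ :=
  (Complex.I * ν / γ) • opCross (k + 1) k F C

/-- The discretized diffusion operator `𝒟_k = 2 ∇_{C_k} × Ω_k`. -/
def diffOp [NeZero N] (γ ν : ℝ) (k : Fin N) (F : (Fin N → E3) → ℂ) (C : Fin N → E3) :
    Fin 3 → ℂ :=
  (2:ℂ) • vcurl k (vortOp γ ν k F) C

/-- The discretized velocity operator `U_k = (1/log(1/ρ)) BS_ℓ ∘ Ω_k`,
with `BS_ℓ` acting in the variable `C_k`. -/
def velOp [NeZero N] (χ : E3 → ℝ) (ℓ ρ γ ν : ℝ) (k : Fin N) (F : (Fin N → E3) → ℂ)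
    (C : Fin N → E3) : Fin 3 → ℂ :=
  (Real.log (1 / ρ))⁻¹ • BSregC χ ℓ (fun x => vortOp γ ν k F (Function.update C k x)) (C k)

/-- Levi-Civita symbol on `Fin 3`. -/
def levi3 (a b c : Fin 3) : ℝ :=
  if (a, b, c) = (0, 1, 2) ∨ (a, b, c) = (1, 2, 0) ∨ (a, b, c) = (2, 0, 1) then 1
  else if (a, b, c) = (2, 1, 0) ∨ (a, b, c) = (1, 0, 2) ∨ (a, b, c) = (0, 2, 1) then -1
  else 0

/-- The discretized advection operator `(Ω_{k+3} × U_k)_α = ε_{αij} Ω^i_{k+3} ∘ U^j_k`. -/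
def advecOp [NeZero N] (χ : E3 → ℝ) (ℓ ρ γ ν : ℝ) (k : Fin N) (F : (Fin N → E3) → ℂ)
    (C : Fin N → E3) : Fin 3 → ℂ :=
  fun α => ∑ i : Fin 3, ∑ j : Fin 3,
    (levi3 α i j : ℂ) * vortOp γ ν (k + 3) (fun D => velOp χ ℓ ρ γ ν k F D j) C i

/-- Migdal's discretized vorticity operator
`Ω^M_k = (iν/γ)(∑_{j=k+1}^{N-1} ∇_{C_j} + ½∇_{C_k}) × ∇_{C_k}`. -/
def vortOpM [NeZero N] (γ ν : ℝ) (k : Fin N) (F : (Fin N → E3) → ℂ) (C : Fin N → E3) :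
    Fin 3 → ℂ :=
  (Complex.I * ν / γ) •
    ((∑ j ∈ Finset.univ.filter (fun j : Fin N => (k : ℕ) < (j : ℕ)), opCross j k F C)
      + (2:ℂ)⁻¹ • opCross k k F C)

/-- Migdal's discretized diffusion operator `𝒟^M_k = 2 ∇_{C_k} × Ω^M_k`. -/
def diffOpM [NeZero N] (γ ν : ℝ) (k : Fin N) (F : (Fin N → E3) → ℂ) (C : Fin N → E3) :
    Fin 3 → ℂ :=
  (2:ℂ) • vcurl k (vortOpM γ ν k F) C

/-- Migdal's discretized velocity operator `U^M_k = (1/log(1/ρ)) BS_ℓ ∘ Ω^M_k`. -/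
def velOpM [NeZero N] (χ : E3 → ℝ) (ℓ ρ γ ν : ℝ) (k : Fin N) (F : (Fin N → E3) → ℂ)
    (C : Fin N → E3) : Fin 3 → ℂ :=
  (Real.log (1 / ρ))⁻¹ • BSregC χ ℓ (fun x => vortOpM γ ν k F (Function.update C k x)) (C k)

/-- The loop functional `Ψ[u,C] = exp((iγ/ν) Γ[u,C])` as a function of the vertices. -/
def loopExp (γ ν : ℝ) (N : ℕ) [NeZero N] (u : E3 → E3) (C : Fin N → E3) : ℂ :=
  Complex.exp (Complex.I * γ / ν * (circulation N u C : ℂ))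

/-- The momentum loop functional `Ψ[P,C](t) = exp((iγ/ν) ∑_k P_k(t)·ΔC_k)`. -/
def momFun (γ ν : ℝ) (N : ℕ) [NeZero N] (P : Fin N → ℝ → Fin 3 → ℂ) (t : ℝ)
    (C : Fin N → E3) : ℂ :=
  Complex.exp (Complex.I * γ / ν * ∑ k : Fin N, cdot (P k t) (toC3 (C (k + 1) - C k)))

/-- The expression `E_k` of the discretized momentum loop equation, as a function of
`ΔP_{k-1}, ΔP_k, ΔP_{k+2}, ΔP_{k+3}` (and of `log N`). -/
def EkDef (γ ν NR : ℝ) (dPm dP dP2 dP3 : Fin 3 → ℂ) : Fin 3 → ℂ :=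
  ((Real.log NR)⁻¹ : ℂ) •
      ((Complex.I * γ / ν) •
        ccross3 (ccross3 dP3 dP2) (dP - (cdot dPm dP / cdot dPm dPm) • dPm))
    + ((2 * γ ^ 2 / ν : ℝ) : ℂ) • (cdot dPm dPm • dP - cdot dPm dP • dPm)

section ParametricIntegral

variable {H : Type*} [NormedAddCommGroup H] [NormedSpace ℝ H]

/-- Differentiation under the integral sign over `[0, 1]` for an integrand which is jointly
continuous together with its partial derivative. -/
theorem hasFDerivAt_intervalIntegral_of_continuous [FiniteDimensional ℝ H]
    {f : H → ℝ → ℝ} {f' : H → ℝ → H →L[ℝ] ℝ}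
    (hf : Continuous (Function.uncurry f)) (hf' : Continuous (Function.uncurry f'))
    (hd : ∀ x a, HasFDerivAt (fun y => f y a) (f' x a) x) (x : H) :
    HasFDerivAt (fun y => ∫ a in (0:ℝ)..1, f y a) (∫ a in (0:ℝ)..1, f' x a) x := by
  have : ProperSpace H := FiniteDimensional.proper_real H
  obtain ⟨M, hM⟩ := ((isCompact_closedBall x 1).prod (isCompact_Icc (a := (0:ℝ)) (b := 1))
    ).exists_bound_of_continuousOn hf'.continuousOn
  refine intervalIntegral.hasFDerivAt_integral_of_dominated_of_fderiv_le (bound := fun _ => M)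
    (F' := f') (Metric.closedBall_mem_nhds x one_pos) ?_ ?_ ?_ ?_ ?_ ?_
  · exact Filter.Eventually.of_forall fun y =>
      (hf.comp (Continuous.prodMk_right y)).aestronglyMeasurable
  · exact (hf.comp (Continuous.prodMk_right x)).intervalIntegrable _ _
  · exact (hf'.comp (Continuous.prodMk_right x)).aestronglyMeasurable
  · refine Filter.Eventually.of_forall fun a ha y hy => hM (y, a) ⟨hy, ?_⟩
    rw [Set.uIoc_of_le zero_le_one] at ha
    exact Set.Ioc_subset_Icc_self ha
  · exact intervalIntegrable_const
  · exact Filter.Eventually.of_forall fun a _ y _ => hd y a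

/-- The integral of `u` along the segment with endpoints `P x` and `Q x`. -/
def segLine (u : E3 → E3) (P Q : H →L[ℝ] E3) (x : H) : ℝ :=
  ∫ a in (0:ℝ)..(1:ℝ), ⟪u ((1 - a) • P x + a • Q x), Q x - P x⟫

/-- The point with parameter `a` of the segment with endpoints `P` and `Q`. -/
def segPoint (P Q : H →L[ℝ] E3) (a : ℝ) : H →L[ℝ] E3 := (1 - a) • P + a • Q

/-- The integrand of the derivative of `segLine`. -/
def segLineD (u : E3 → E3) (P Q : H →L[ℝ] E3) (w : H) (x : H) (a : ℝ) : ℝ :=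
  ⟪fderiv ℝ u (segPoint P Q a x) (segPoint P Q a w), (Q - P) x⟫ +
    ⟪u (segPoint P Q a x), (Q - P) w⟫

/-- The integrand of the second derivative of `segLine`. -/
def segLineD2 (u : E3 → E3) (P Q : H →L[ℝ] E3) (x : H) (a : ℝ) (v w : H) : ℝ :=
  ⟪fderiv ℝ (fderiv ℝ u) (segPoint P Q a x) (segPoint P Q a v) (segPoint P Q a w), (Q - P) x⟫ +
    ⟪fderiv ℝ u (segPoint P Q a x) (segPoint P Q a w), (Q - P) v⟫ +
    ⟪fderiv ℝ u (segPoint P Q a x) (segPoint P Q a v), (Q - P) w⟫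

variable {u : E3 → E3} (P Q : H →L[ℝ] E3)

theorem continuous_segPoint : Continuous fun p : H × ℝ => segPoint P Q p.2 p.1 := by
  simp only [segPoint, add_apply, smul_apply]
  fun_prop

theorem hasFDerivAt_segLine_integrand (hu : ContDiff ℝ 2 u) (x : H) (a : ℝ) :
    HasFDerivAt (fun y => ⟪u (segPoint P Q a y), (Q - P) y⟫)
      ((innerSL ℝ ((Q - P) x)).comp ((fderiv ℝ u (segPoint P Q a x)).comp (segPoint P Q a)) +
        (innerSL ℝ (u (segPoint P Q a x))).comp (Q - P)) x := by
  have h1 : HasFDerivAt (fun y => u (segPoint P Q a y)) _ x :=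
    ((hu.differentiable (by norm_num)).differentiableAt.hasFDerivAt).comp x
      (segPoint P Q a).hasFDerivAt
  refine (h1.inner ℝ (Q - P).hasFDerivAt).congr_fderiv ?_
  ext w
  simp [inner_sub_right, real_inner_comm]
  ring

theorem hasFDerivAt_segLineD (hu : ContDiff ℝ 2 u) (w x : H) (a : ℝ) :
    HasFDerivAt (fun y => segLineD u P Q w y a)
      ((innerSL ℝ ((Q - P) x)).comp (((fderiv ℝ (fderiv ℝ u) (segPoint P Q a x)).flip
          (segPoint P Q a w)).comp (segPoint P Q a)) +
        (innerSL ℝ (fderiv ℝ u (segPoint P Q a x) (segPoint P Q a w))).comp (Q - P) +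
        (innerSL ℝ ((Q - P) w)).comp ((fderiv ℝ u (segPoint P Q a x)).comp (segPoint P Q a))) x := by
  have hu' : ContDiff ℝ 1 (fderiv ℝ u) := hu.fderiv_right (by norm_num)
  have h1 : HasFDerivAt (fun y => u (segPoint P Q a y)) _ x :=
    ((hu.differentiable (by norm_num)).differentiableAt.hasFDerivAt).comp x
      (segPoint P Q a).hasFDerivAt
  have h2 : HasFDerivAt (fun y => fderiv ℝ u (segPoint P Q a y)) _ x :=
    ((hu'.differentiable (by norm_num)).differentiableAt.hasFDerivAt).comp x
      (segPoint P Q a).hasFDerivAt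
  have h3 := h2.clm_apply (hasFDerivAt_const (segPoint P Q a w) x)
  refine ((h3.inner ℝ (Q - P).hasFDerivAt).add
    (h1.inner ℝ (hasFDerivAt_const ((Q - P) w) x))).congr_fderiv ?_
  ext v
  simp [inner_sub_right, real_inner_comm]
  ring

theorem hasFDerivAt_segLine [FiniteDimensional ℝ H] (hu : ContDiff ℝ 2 u) (x : H) :
    ∃ L : H →L[ℝ] ℝ, HasFDerivAt (segLine u P Q) L x ∧
      ∀ w, L w = ∫ a in (0:ℝ)..1, segLineD u P Q w x a := by
  have hu' : Continuous (fderiv ℝ u) := hu.continuous_fderiv (by norm_num)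
  have hs := continuous_segPoint P Q
  have hsp : Continuous (segPoint P Q) := by unfold segPoint; fun_prop
  set f' : H → ℝ → H →L[ℝ] ℝ := fun x a =>
    (innerSL ℝ ((Q - P) x)).comp ((fderiv ℝ u (segPoint P Q a x)).comp (segPoint P Q a)) +
        (innerSL ℝ (u (segPoint P Q a x))).comp (Q - P)
  have hf' : Continuous (Function.uncurry f') := by
    simp only [Function.uncurry_def, f']
    have := hu'.comp hs
    have := hu.continuous.comp hs
    simp only [Function.comp_def] at *
    fun_prop
  refine ⟨_, hasFDerivAt_intervalIntegral_of_continuous (f' := f') ?_ hf' (fun x a =>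
    hasFDerivAt_segLine_integrand P Q hu x a) x, fun w => ?_⟩
  · exact (hu.continuous.comp hs).inner ((Q - P).continuous.comp continuous_fst)
  · rw [ContinuousLinearMap.intervalIntegral_apply (φ := f' x)
      ((hf'.comp (Continuous.prodMk_right x)).intervalIntegrable _ _)]
    simp [f', segLineD, inner_sub_right, real_inner_comm]

theorem hasFDerivAt_fderiv_segLine [FiniteDimensional ℝ H] (hu : ContDiff ℝ 2 u) (w x : H) :
    ∃ L : H →L[ℝ] ℝ, HasFDerivAt (fun y => fderiv ℝ (segLine u P Q) y w) L x ∧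
      ∀ v, L v = ∫ a in (0:ℝ)..1, segLineD2 u P Q x a v w := by
  have hu1 : ContDiff ℝ 1 (fderiv ℝ u) := hu.fderiv_right (by norm_num)
  have hu' : Continuous (fderiv ℝ u) := hu.continuous_fderiv (by norm_num)
  have hu'' : Continuous (fderiv ℝ (fderiv ℝ u)) := hu1.continuous_fderiv (by norm_num)
  have hs := continuous_segPoint P Q
  have hsp : Continuous (segPoint P Q) := by unfold segPoint; fun_prop
  have he : (fun y => fderiv ℝ (segLine u P Q) y w) =
      fun y => ∫ a in (0:ℝ)..1, segLineD u P Q w y a := by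
    ext y
    obtain ⟨L, hL, hLw⟩ := hasFDerivAt_segLine P Q hu y
    rw [hL.fderiv, hLw]
  have c1 := hu'.comp hs
  have c2 := hu.continuous.comp hs
  have c4 := hu''.comp hs
  simp only [Function.comp_def] at c1 c2 c4
  set f' : H → ℝ → H →L[ℝ] ℝ := fun x a =>
    (innerSL ℝ ((Q - P) x)).comp (((fderiv ℝ (fderiv ℝ u) (segPoint P Q a x)).flip
          (segPoint P Q a w)).comp (segPoint P Q a)) +
        (innerSL ℝ (fderiv ℝ u (segPoint P Q a x) (segPoint P Q a w))).comp (Q - P) +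
        (innerSL ℝ ((Q - P) w)).comp ((fderiv ℝ u (segPoint P Q a x)).comp (segPoint P Q a))
  have hf' : Continuous (Function.uncurry f') := by
    simp only [Function.uncurry_def, f']
    have c5 : Continuous fun p : H × ℝ => (fderiv ℝ (fderiv ℝ u) (segPoint P Q p.2 p.1)).flip :=
      (ContinuousLinearMap.flipₗᵢ ℝ E3 E3 E3).continuous.comp c4
    fun_prop
  rw [he]
  refine ⟨_, hasFDerivAt_intervalIntegral_of_continuous (f' := f') ?_ hf' (fun x a =>
    hasFDerivAt_segLineD P Q hu w x a) x, fun v => ?_⟩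
  · simp only [Function.uncurry_def, segLineD]
    fun_prop
  · rw [ContinuousLinearMap.intervalIntegral_apply (φ := f' x)
      ((hf'.comp (Continuous.prodMk_right x)).intervalIntegrable _ _)]
    simp [f', segLineD2, inner_sub_right, real_inner_comm]

theorem segLineD2_comm (hu : ContDiff ℝ 2 u) (x : H) (a : ℝ) (v w : H) :
    segLineD2 u P Q x a v w = segLineD2 u P Q x a w v := by
  have := hu.contDiffAt.isSymmSndFDerivAt (x := segPoint P Q a x) (by simp)
    (segPoint P Q a v) (segPoint P Q a w)
  unfold segLineD2
  rw [this]
  ring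

theorem continuous_segLineD2 (hu : ContDiff ℝ 2 u) (x v w : H) :
    Continuous fun a => segLineD2 u P Q x a v w := by
  have hu1 : ContDiff ℝ 1 (fderiv ℝ u) := hu.fderiv_right (by norm_num)
  have hu' : Continuous (fderiv ℝ u) := hu.continuous_fderiv (by norm_num)
  have hu'' : Continuous (fderiv ℝ (fderiv ℝ u)) := hu1.continuous_fderiv (by norm_num)
  have hsp : Continuous (segPoint P Q) := by unfold segPoint; fun_prop
  unfold segLineD2
  fun_prop

end ParametricIntegral

section Vertices

variable {N : ℕ}

/-- The `j`-th coordinate direction of the vertex `k`. -/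
def vertexDir (k : Fin N) (j : Fin 3) : Fin N → E3 := Pi.single k (e3 j)

theorem fderiv_update_apply {F : Type*} [NormedAddCommGroup F] [NormedSpace ℝ F]
    {f : (Fin N → E3) → F} {f' : (Fin N → E3) →L[ℝ] F} {C : Fin N → E3}
    (hf : HasFDerivAt f f' C) (k : Fin N) (w : E3) :
    fderiv ℝ (fun x => f (Function.update C k x)) (C k) w = f' (Pi.single k w) := by
  have hf' : HasFDerivAt f f' (Function.update C k (C k)) := by simpa using hf
  have h : HasFDerivAt (fun x => f (Function.update C k x)) _ (C k) :=
    hf'.comp (C k) (hasFDerivAt_update C (C k))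
  rw [h.fderiv]
  simp only [ContinuousLinearMap.comp_apply]
  congr 1
  ext i
  by_cases hi : i = k
  · subst hi; simp
  · simp [hi]

theorem vpdR_eq {F : (Fin N → E3) → ℝ} {F' : (Fin N → E3) →L[ℝ] ℝ} {C : Fin N → E3}
    (hF : HasFDerivAt F F' C) (k : Fin N) (j : Fin 3) : vpdR k j F C = F' (vertexDir k j) :=
  fderiv_update_apply hF k _

theorem vpd_eq {F : (Fin N → E3) → ℂ} {F' : (Fin N → E3) →L[ℝ] ℂ} {C : Fin N → E3}
    (hF : HasFDerivAt F F' C) (k : Fin N) (j : Fin 3) : vpd k j F C = F' (vertexDir k j) :=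
  fderiv_update_apply hF k _

theorem vgradR_apply (F : (Fin N → E3) → ℝ) (C : Fin N → E3) (k : Fin N) (j : Fin 3) :
    vgradR k F C j = vpdR k j F C := by
  have h : vgradR k F C j = ⟪vgradR k F C, e3 j⟫ := by
    simp [e3, EuclideanSpace.inner_single_right]
  rw [h, vgradR, gradient, InnerProductSpace.toDual_symm_apply, vpdR]

variable [NeZero N] {u : E3 → E3}

/-- The evaluation of a polygon at its vertex `k`. -/
abbrev vertexProj (k : Fin N) : (Fin N → E3) →L[ℝ] E3 := ContinuousLinearMap.proj k

theorem circulation_eq_sum_segLine :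
    circulation N u = ∑ k : Fin N, segLine u (vertexProj k) (vertexProj (k + 1)) := by
  ext C
  simp [circulation, segLine]

theorem differentiable_circulation (hu : ContDiff ℝ 2 u) : Differentiable ℝ (circulation N u) := by
  intro C
  rw [circulation_eq_sum_segLine]
  refine DifferentiableAt.sum fun k _ => ?_
  obtain ⟨L, hL, -⟩ := hasFDerivAt_segLine (vertexProj k) (vertexProj (k + 1)) hu C
  exact hL.differentiableAt

theorem hasFDerivAt_fderiv_circulation (hu : ContDiff ℝ 2 u) (C w : Fin N → E3) :
    ∃ L : (Fin N → E3) →L[ℝ] ℝ, HasFDerivAt (fun D => fderiv ℝ (circulation N u) D w) L C ∧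
      ∀ v, L v = ∑ k : Fin N,
        ∫ a in (0:ℝ)..1, segLineD2 u (vertexProj k) (vertexProj (k + 1)) C a v w := by
  choose L hL hLv using fun k : Fin N =>
    hasFDerivAt_fderiv_segLine (vertexProj k) (vertexProj (k + 1)) hu w C
  refine ⟨∑ k, L k, ?_, fun v => by simp [hLv]⟩
  have he : (fun D => fderiv ℝ (circulation N u) D w) = fun D => ∑ k : Fin N,
      fderiv ℝ (segLine u (vertexProj k) (vertexProj (k + 1))) D w := by
    ext D
    rw [circulation_eq_sum_segLine, fderiv_sum]
    · simp
    · intro k _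
      obtain ⟨L, hL, -⟩ := hasFDerivAt_segLine (vertexProj k) (vertexProj (k + 1)) hu D
      exact hL.differentiableAt
  rw [he]
  exact HasFDerivAt.fun_sum fun k _ => hL k

theorem vpdR_circulation (hu : ContDiff ℝ 2 u) (k : Fin N) (j : Fin 3) :
    vpdR k j (circulation N u) = fun C => fderiv ℝ (circulation N u) C (vertexDir k j) := by
  ext C
  exact vpdR_eq (differentiable_circulation hu C).hasFDerivAt k j

theorem vpdR_vpdR_circulation (hu : ContDiff ℝ 2 u) (C : Fin N → E3) (a b : Fin N) (i j : Fin 3) :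
    vpdR a i (vpdR b j (circulation N u)) C = ∑ m : Fin N, ∫ s in (0:ℝ)..1,
      segLineD2 u (vertexProj m) (vertexProj (m + 1)) C s (vertexDir a i) (vertexDir b j) := by
  obtain ⟨L, hL, hLv⟩ := hasFDerivAt_fderiv_circulation hu C (vertexDir b j)
  rw [vpdR_circulation hu, vpdR_eq hL, hLv]

theorem vpd_loopExp (hu : ContDiff ℝ 2 u) (γ ν : ℝ) (k : Fin N) (j : Fin 3) :
    vpd k j (loopExp γ ν N u) = fun C => Complex.I * γ / ν * (loopExp γ ν N u C *
      (vpdR k j (circulation N u) C : ℝ)) := by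
  ext C
  have h := (differentiable_circulation hu C).hasFDerivAt
  have h1 : HasFDerivAt (loopExp γ ν N u) _ C :=
    ((Complex.ofRealCLM.hasFDerivAt.comp C h).const_mul _).cexp
  rw [vpd_eq h1, vpdR_eq h]
  simp [loopExp]
  ring

theorem vpd_vpd_loopExp (hu : ContDiff ℝ 2 u) (γ ν : ℝ) (C : Fin N → E3) (a b : Fin N)
    (i j : Fin 3) :
    vpd a i (vpd b j (loopExp γ ν N u)) C = Complex.I * γ / ν * (loopExp γ ν N u C *
      (vpdR a i (vpdR b j (circulation N u)) C : ℝ)) +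
      (Complex.I * γ / ν) ^ 2 * (loopExp γ ν N u C * ((vpdR a i (circulation N u) C : ℝ) *
        (vpdR b j (circulation N u) C : ℝ))) := by
  obtain ⟨L, hL, -⟩ := hasFDerivAt_fderiv_circulation hu C (vertexDir b j)
  have h := (differentiable_circulation hu C).hasFDerivAt
  have h1 : HasFDerivAt (loopExp γ ν N u) _ C :=
    ((Complex.ofRealCLM.hasFDerivAt.comp C h).const_mul _).cexp
  rw [← vpdR_circulation hu] at hL
  have h2 : HasFDerivAt (fun D => Complex.I * γ / ν * (loopExp γ ν N u D *
      (vpdR b j (circulation N u) D : ℝ))) _ C :=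
    (h1.mul (Complex.ofRealCLM.hasFDerivAt.comp C hL)).const_mul _
  rw [vpd_loopExp hu, vpd_eq h2, vpdR_eq hL, vpdR_eq h]
  simp [loopExp]
  ring

end Vertices

section Curl

/-- The curl as a linear function of the Jacobian. -/
def curlCLM : (E3 →L[ℝ] E3) →L[ℝ] E3 :=
  LinearMap.toContinuousLinearMap
    { toFun := fun A => vec3 (A (e3 1) 2 - A (e3 2) 1) (A (e3 2) 0 - A (e3 0) 2)
        (A (e3 0) 1 - A (e3 1) 0)
      map_add' := fun A B => by
        ext i
        fin_cases i <;> simp [vec3] <;> ring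
      map_smul' := fun c A => by
        ext i
        fin_cases i <;> simp [vec3] <;> ring }

variable {u : E3 → E3}

theorem curl3_eq_curlCLM : curl3 u = fun x => curlCLM (fderiv ℝ u x) := rfl

theorem contDiff_curl3 (hu : ContDiff ℝ 2 u) : ContDiff ℝ 1 (curl3 u) := by
  rw [curl3_eq_curlCLM]
  exact curlCLM.contDiff.comp (hu.fderiv_right (by norm_num))

theorem bddAbove_norm_iteratedFDeriv_curl3 (hu : ContDiff ℝ 2 u) {M : ℝ}
    (hM : ∀ x, ‖iteratedFDeriv ℝ 2 u x‖ ≤ M) :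
    BddAbove (Set.range fun x => ‖iteratedFDeriv ℝ 1 (curl3 u) x‖) := by
  refine ⟨‖curlCLM‖ * M, ?_⟩
  rintro _ ⟨x, rfl⟩
  have hd : DifferentiableAt ℝ (fderiv ℝ u) x :=
    ((hu.fderiv_right (m := 1) (by norm_num)).differentiable (by norm_num)) x
  have h : HasFDerivAt (curl3 u) (curlCLM.comp (fderiv ℝ (fderiv ℝ u) x)) x :=
    curlCLM.hasFDerivAt.comp x hd.hasFDerivAt
  simp only [norm_iteratedFDeriv_one, h.fderiv]
  refine (curlCLM.opNorm_comp_le _).trans (mul_le_mul_of_nonneg_left ?_ (norm_nonneg _))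
  rw [← norm_iteratedFDeriv_one, norm_iteratedFDeriv_fderiv]
  exact hM x

theorem norm_sub_le_supDeriv_one {ω : E3 → E3} (hω : Differentiable ℝ ω)
    (hb : BddAbove (Set.range fun x => ‖iteratedFDeriv ℝ 1 ω x‖)) (x y : E3) :
    ‖ω y - ω x‖ ≤ supDeriv 1 ω * ‖y - x‖ := by
  refine Convex.norm_image_sub_le_of_norm_fderiv_le (𝕜 := ℝ) (s := Set.univ)
    (fun z _ => hω z) (fun z _ => ?_) convex_univ (Set.mem_univ x) (Set.mem_univ y)
  rw [← norm_iteratedFDeriv_one]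
  exact le_ciSup hb z

theorem norm_segAvg_sub_le {ω : E3 → E3} (hω : Differentiable ℝ ω)
    (hb : BddAbove (Set.range fun x => ‖iteratedFDeriv ℝ 1 ω x‖)) (xm y xp : E3) :
    ‖segAvg ω xm y xp - ∫ a in (0:ℝ)..1, ω ((1 - a) • y + a • xp)‖ ≤
      supDeriv 1 ω * ‖xp - xm‖ := by
  have hc := hω.continuous
  have hsub : ∫ a in (0:ℝ)..1, ω ((1 - a) • y + a • xp) =
      ∫ a in (0:ℝ)..1, ω (a • y + (1 - a) • xp) := by
    have := intervalIntegral.integral_comp_sub_left (a := 0) (b := 1)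
      (fun a : ℝ => ω ((1 - a) • y + a • xp)) 1
    simpa using this.symm
  rw [segAvg, hsub, ← intervalIntegral.integral_sub]
  · have h0 : 0 ≤ supDeriv 1 ω := Real.iSup_nonneg fun x => norm_nonneg _
    refine (intervalIntegral.norm_integral_le_of_norm_le_const
      (C := supDeriv 1 ω * ‖xp - xm‖) fun a ha => ?_).trans (by simp)
    rw [Set.uIoc_of_le zero_le_one] at ha
    refine (norm_sub_le_supDeriv_one hω hb _ _).trans (mul_le_mul_of_nonneg_left ?_ h0)
    have he : a • y + (1 - a) • ((2:ℝ)⁻¹ • (xm + xp)) - (a • y + (1 - a) • xp) =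
        (-((1 - a) / 2)) • (xp - xm) := by module
    rw [he, norm_smul]
    refine mul_le_of_le_one_left (norm_nonneg _) ?_
    rw [Real.norm_eq_abs, abs_le]
    constructor <;> linarith [ha.1, ha.2]
  · exact Continuous.intervalIntegrable (by fun_prop) _ _
  · exact Continuous.intervalIntegrable (by fun_prop) _ _

end Curl

section AreaDerivative

variable {N : ℕ} [NeZero N] {u : E3 → E3}

theorem segLineD2_eq_zero {H : Type*} [NormedAddCommGroup H] [NormedSpace ℝ H]
    {P Q : H →L[ℝ] E3} {v : H} (hP : P v = 0) (hQ : Q v = 0) (x : H) (a : ℝ) (w : H) :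
    segLineD2 u P Q x a v w = 0 := by
  simp [segLineD2, segPoint, hP, hQ]

theorem segLineD2_vertexDir_eq_zero (hu : ContDiff ℝ 2 u) {a b m : Fin N}
    (h : (m ≠ a ∧ m + 1 ≠ a) ∨ (m ≠ b ∧ m + 1 ≠ b)) (C : Fin N → E3) (s : ℝ) (i j : Fin 3) :
    segLineD2 u (vertexProj m) (vertexProj (m + 1)) C s (vertexDir a i) (vertexDir b j) = 0 := by
  rcases h with ⟨h1, h2⟩ | ⟨h1, h2⟩
  · exact segLineD2_eq_zero (by simp [vertexDir, h1]) (by simp [vertexDir, h2]) _ _ _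
  · rw [segLineD2_comm _ _ hu]
    exact segLineD2_eq_zero (by simp [vertexDir, h1]) (by simp [vertexDir, h2]) _ _ _

theorem gradCross_self_circulation (hu : ContDiff ℝ 2 u) (k : Fin N) (C : Fin N → E3) :
    gradCross k k (circulation N u) C = 0 := by
  have h (i j : Fin 3) : vpdR k i (vpdR k j (circulation N u)) C =
      vpdR k j (vpdR k i (circulation N u)) C := by
    simp only [vpdR_vpdR_circulation hu, segLineD2_comm _ _ hu _ _ (vertexDir k i)]
  ext i
  fin_cases i <;> simp [gradCross, vec3, h 1 2, h 2 0, h 0 1]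

theorem gradCross_circulation_of_not_adjacent (hu : ContDiff ℝ 2 u) {j k : Fin N} (h : j ≠ k)
    (h1 : j ≠ k + 1) (h2 : k ≠ j + 1) (C : Fin N → E3) :
    gradCross j k (circulation N u) C = 0 := by
  have h0 (i l : Fin 3) : vpdR j i (vpdR k l (circulation N u)) C = 0 := by
    rw [vpdR_vpdR_circulation hu]
    refine Finset.sum_eq_zero fun m _ => ?_
    have hm : (m ≠ j ∧ m + 1 ≠ j) ∨ (m ≠ k ∧ m + 1 ≠ k) := by grind
    simp [segLineD2_vertexDir_eq_zero hu hm]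
  ext i
  fin_cases i <;> simp [gradCross, vec3, h0]

theorem vpdR_antisymm_circulation_succ (hu : ContDiff ℝ 2 u) {k : Fin N} (hk : k + 1 ≠ k)
    (hk' : k + 1 + 1 ≠ k) (C : Fin N → E3) (i j : Fin 3) :
    vpdR (k + 1) i (vpdR k j (circulation N u)) C -
      vpdR (k + 1) j (vpdR k i (circulation N u)) C =
    -∫ a in (0:ℝ)..1, (fderiv ℝ u ((1 - a) • C k + a • C (k + 1)) (e3 i) j -
      fderiv ℝ u ((1 - a) • C k + a • C (k + 1)) (e3 j) i) := by
  have h (i j : Fin 3) : vpdR (k + 1) i (vpdR k j (circulation N u)) C = ∫ s in (0:ℝ)..1,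
      segLineD2 u (vertexProj k) (vertexProj (k + 1)) C s (vertexDir (k + 1) i)
        (vertexDir k j) := by
    rw [vpdR_vpdR_circulation hu]
    refine Finset.sum_eq_single k (fun m _ hm => ?_) (by simp)
    have hm' : (m ≠ k + 1 ∧ m + 1 ≠ k + 1) ∨ (m ≠ k ∧ m + 1 ≠ k) := by grind
    simp [segLineD2_vertexDir_eq_zero hu hm']
  rw [h, h, ← intervalIntegral.integral_sub
    ((continuous_segLineD2 _ _ hu _ _ _).intervalIntegrable _ _)
    ((continuous_segLineD2 _ _ hu _ _ _).intervalIntegrable _ _), ← intervalIntegral.integral_neg]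
  congr 1
  ext a
  have hs := hu.contDiffAt.isSymmSndFDerivAt (x := (1 - a) • C k + a • C (k + 1)) (by simp)
    (e3 i) (e3 j)
  have hin (x : E3) (l : Fin 3) : ⟪x, e3 l⟫ = x l := by
    simp [e3, EuclideanSpace.inner_single_right]
  have hp : segPoint (vertexProj k) (vertexProj (k + 1)) a C =
    (1 - a) • C k + a • C (k + 1) := by simp [segPoint]
  have hv (l : Fin 3) : segPoint (vertexProj k) (vertexProj (k + 1)) a (vertexDir (k + 1) l) =
    a • e3 l := by simp [segPoint, vertexDir, hk.symm]
  have hw (l : Fin 3) : segPoint (vertexProj k) (vertexProj (k + 1)) a (vertexDir k l) =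
    (1 - a) • e3 l := by simp [segPoint, vertexDir, hk]
  have hv' (l : Fin 3) : (vertexProj (k + 1) - vertexProj k : (Fin N → E3) →L[ℝ] E3)
      (vertexDir (k + 1) l) = e3 l := by
    simp [vertexDir, hk.symm]
  have hw' (l : Fin 3) : (vertexProj (k + 1) - vertexProj k : (Fin N → E3) →L[ℝ] E3)
      (vertexDir k l) = -e3 l := by
    simp [vertexDir, hk]
  simp only [segLineD2, hp, hv, hw, hv', hw', map_smul, smul_apply, hs,
    inner_neg_right, hin,
    PiLp.smul_apply, smul_eq_mul]
  ring

theorem gradCross_succ_circulation (hu : ContDiff ℝ 2 u) {k : Fin N} (hk : k + 1 ≠ k)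
    (hk' : k + 1 + 1 ≠ k) (C : Fin N → E3) :
    gradCross (k + 1) k (circulation N u) C =
      -∫ a in (0:ℝ)..1, curl3 u ((1 - a) • C k + a • C (k + 1)) := by
  have hi : IntervalIntegrable (fun a : ℝ => curl3 u ((1 - a) • C k + a • C (k + 1)))
      volume 0 1 := by
    have := (contDiff_curl3 hu).continuous
    exact Continuous.intervalIntegrable (by fun_prop) _ _
  ext i
  have hc := (EuclideanSpace.proj i : E3 →L[ℝ] ℝ
    ).intervalIntegral_comp_comm hi
  simp only [PiLp.proj_apply] at hc
  rw [PiLp.neg_apply, ← hc]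
  fin_cases i <;>
    simp [gradCross, vec3, curl3, vpdR_antisymm_circulation_succ hu hk hk']

theorem gradCrossM_circulation (hu : ContDiff ℝ 2 u) {k : Fin N} (hk : 2 ≤ (k : ℕ))
    (hk' : (k : ℕ) ≤ N - 2) (C : Fin N → E3) :
    gradCrossM k (circulation N u) C =
      -∫ a in (0:ℝ)..1, curl3 u ((1 - a) • C k + a • C (k + 1)) := by
  have hN : 4 ≤ N := by have := k.isLt; omega
  have hval (j : Fin N) : ((j + 1 : Fin N) : ℕ) = if (j : ℕ) + 1 = N then 0 else (j : ℕ) + 1 := by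
    have := j.isLt
    rw [Fin.val_add, Fin.val_one', Nat.mod_eq_of_lt (a := 1) (by omega)]
    split_ifs with h
    · simp [h]
    · exact Nat.mod_eq_of_lt (by omega)
  have h1 := hval k
  have h2 := hval (k + 1)
  rw [if_neg (by omega)] at h1
  rw [h1] at h2
  rw [gradCrossM, gradCross_self_circulation hu, smul_zero, add_zero,
    Finset.sum_eq_single (k + 1)]
  · refine gradCross_succ_circulation hu (fun h => ?_) (fun h => ?_) C
    · rw [h] at h1; omega
    · rw [h] at h2; split_ifs at h2 <;> omega
  · intro j hj hjk
    have hj' : (k : ℕ) < j := by simpa using hj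
    refine gradCross_circulation_of_not_adjacent hu (fun h => ?_) hjk (fun h => ?_) C
    · rw [h] at hj'; omega
    · have h3 := hval j
      rw [← h] at h3; split_ifs at h3 <;> omega
  · intro h
    exact absurd (Finset.mem_filter.mpr ⟨Finset.mem_univ _, by omega⟩) h

end AreaDerivative

section VorticityOperator

variable {N : ℕ} [NeZero N] {u : E3 → E3}

theorem toC3_add (v w : E3) : toC3 (v + w) = toC3 v + toC3 w := by
  ext j; simp [toC3]

theorem toC3_sum {ι : Type*} (s : Finset ι) (v : ι → E3) :
    toC3 (∑ j ∈ s, v j) = ∑ j ∈ s, toC3 (v j) := by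
  ext j; simp [toC3, Finset.sum_apply]

theorem toC3_smul (r : ℝ) (v : E3) : toC3 (r • v) = (r : ℂ) • toC3 v := by
  ext j; simp [toC3]

theorem cross3_sum_left {ι : Type*} (s : Finset ι) (v : ι → E3) (w : E3) :
    cross3 (∑ j ∈ s, v j) w = ∑ j ∈ s, cross3 (v j) w := by
  ext i
  fin_cases i <;> simp [cross3, vec3, Finset.sum_mul, Finset.sum_sub_distrib]

theorem cross3_self (v : E3) : cross3 v v = 0 := by
  ext i
  fin_cases i <;> simp [cross3, vec3] <;> ring

theorem opCross_loopExp (hu : ContDiff ℝ 2 u) (γ ν : ℝ) (a b : Fin N) (C : Fin N → E3) :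
    opCross a b (loopExp γ ν N u) C =
      (Complex.I * γ / ν * loopExp γ ν N u C) • toC3 (gradCross a b (circulation N u) C) +
      ((Complex.I * γ / ν) ^ 2 * loopExp γ ν N u C) • toC3
        (cross3 (vgradR a (circulation N u) C) (vgradR b (circulation N u) C)) := by
  ext i
  fin_cases i <;>
    simp [opCross, vpd_vpd_loopExp hu, gradCross, cross3, vec3, toC3, vgradR_apply] <;> ring

theorem vortOpM_loopExp (hu : ContDiff ℝ 2 u) {γ ν : ℝ} (hγ : γ ≠ 0) (hν : ν ≠ 0) (k : Fin N)
    (C : Fin N → E3) :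
    vortOpM γ ν k (loopExp γ ν N u) C =
      -(loopExp γ ν N u C • toC3 (gradCrossM k (circulation N u) C)) -
      (Complex.I * γ / ν * loopExp γ ν N u C) • toC3
        (cross3
          (∑ j ∈ Finset.univ.filter (fun j : Fin N => (k : ℕ) < (j : ℕ)),
            vgradR j (circulation N u) C)
          (vgradR k (circulation N u) C)) := by
  have hγ' : (γ : ℂ) ≠ 0 := by exact_mod_cast hγ
  have hν' : (ν : ℂ) ≠ 0 := by exact_mod_cast hν
  have h1 : Complex.I * ν / γ * (Complex.I * γ / ν) = -1 := by
    field_simp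
    exact Complex.I_sq
  have h0 : toC3 0 = 0 := by ext j; simp [toC3]
  simp only [vortOpM, opCross_loopExp hu, cross3_self, h0, smul_zero, add_zero,
    Finset.sum_add_distrib, ← Finset.smul_sum, ← toC3_sum, ← cross3_sum_left, gradCrossM,
    toC3_add, toC3_smul]
  ext i
  simp only [Pi.add_apply, Pi.smul_apply, Pi.sub_apply, Pi.neg_apply, smul_eq_mul,
    Complex.ofReal_inv, Complex.ofReal_ofNat]
  set S := Finset.univ.filter fun j : Fin N => (k : ℕ) < (j : ℕ)
  generalize toC3 (∑ j ∈ S, gradCross j k (circulation N u) C) i = X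
  generalize toC3 (gradCross k k (circulation N u) C) i = Y
  generalize toC3 (cross3 (∑ j ∈ S, vgradR j (circulation N u) C)
    (vgradR k (circulation N u) C)) i = Z
  linear_combination (loopExp γ ν N u C * (X + 2⁻¹ * Y) +
    (Complex.I * γ / ν) * loopExp γ ν N u C * Z) * h1

end VorticityOperator

/-! ## Statement 11 -/
theorem stmt_11 :
    ∃ c > (0:ℝ), ∀ γ ν : ℝ, 0 < γ → 0 < ν →
      ∀ (N : ℕ) [NeZero N], 3 ≤ N →
      ∀ u : E3 → E3, ContDiff ℝ 2 u → (∀ j ≤ 2, ∃ M, ∀ x, ‖iteratedFDeriv ℝ j u x‖ ≤ M) →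
      ∀ C : Fin N → E3, C 0 = 0 →
      ∀ k : Fin N, 2 ≤ (k : ℕ) → (k : ℕ) ≤ N - 2 →
        vortOpM γ ν k (loopExp γ ν N u) C =
              loopExp γ ν N u C • toC3 (segAvg (curl3 u) (C (k - 1)) (C k) (C (k + 1)))
            - loopExp γ ν N u C • toC3
                (gradCrossM k (circulation N u) C
                  + segAvg (curl3 u) (C (k - 1)) (C k) (C (k + 1)))
            - (Complex.I * γ / ν * loopExp γ ν N u C) • toC3
                (cross3
                  (∑ j ∈ Finset.univ.filter (fun j : Fin N => (k : ℕ) < (j : ℕ)),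
                    vgradR j (circulation N u) C)
                  (vgradR k (circulation N u) C)) ∧
        ‖gradCrossM k (circulation N u) C
              + segAvg (curl3 u) (C (k - 1)) (C k) (C (k + 1))‖
            ≤ c * supDeriv 1 (curl3 u) * ‖C (k + 1) - C (k - 1)‖ := by
  refine ⟨1, one_pos, fun γ ν hγ hν N _ _ u hu hb C _ k hk hk' => ⟨?_, ?_⟩⟩
  · rw [vortOpM_loopExp hu hγ.ne' hν.ne', toC3_add, smul_add]
    abel
  · obtain ⟨M, hM⟩ := hb 2 le_rfl
    rw [gradCrossM_circulation hu hk hk', neg_add_eq_sub, one_mul]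
    exact norm_segAvg_sub_le ((contDiff_curl3 hu).differentiable (by norm_num))
      (bddAbove_norm_iteratedFDeriv_curl3 hu hM) _ _ _

end
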